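/- Let H = (V,E) be an m-multigraph on n vertices, m ≥ 2. Suppose there is a nonempty proper subset V_0 ⊊ V such that no edge of H is a multiset of the form {i, i_2, ..., i_m} with i ∈ V_0 and i_2,...,i_m ∉ V_0 (so H is not nicely-connected), and suppose at least one edge of H is contained entirely in V ∖ V_0. Then there exists a Z-eigenpair (λ, x) of the adjacency tensor A_H with λ > 0, every coordinate of x nonnegative, and x_i = 0 for every i ∈ V_0; in particular, x has at least one zero coordinate. -/

import Mathlib

open Finset

noncomputable section

/-- Prepend the vertex `i` to the `(m-1)`-tuple `j`, producing an `m`-tuple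
`(i, j 0, j 1, ...)` of indices. -/
def consVec {n m : ℕ} (i : Fin n) (j : Fin (m - 1) → Fin n) : Fin m → Fin n :=
  fun t => if h : (t : ℕ) = 0 then i else j ⟨(t : ℕ) - 1, by have := t.isLt; omega⟩

/-- The `i`-th entry of the vector `A x^{m-1}`:
`∑_{i_2,…,i_m} a_{i i_2 … i_m} x_{i_2} ⋯ x_{i_m}` (real version). -/
def tContract {n m : ℕ} (A : (Fin m → Fin n) → ℝ) (x : Fin n → ℝ) (i : Fin n) : ℝ :=
  ∑ j : Fin (m - 1) → Fin n, A (consVec i j) * ∏ t, x (j t)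

/-- The `i`-th entry of the vector `A x^{m-1}` (complex vector, real tensor). -/
def tContractC {n m : ℕ} (A : (Fin m → Fin n) → ℝ) (x : Fin n → ℂ) (i : Fin n) : ℂ :=
  ∑ j : Fin (m - 1) → Fin n, (A (consVec i j) : ℂ) * ∏ t, x (j t)

/-- The scalar `A x^m = ∑_{i_1,…,i_m} a_{i_1 … i_m} x_{i_1} ⋯ x_{i_m}`. -/
def tForm {n m : ℕ} (A : (Fin m → Fin n) → ℝ) (x : Fin n → ℝ) : ℝ :=
  ∑ j : Fin m → Fin n, A j * ∏ t, x (j t)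

/-- The adjacency tensor of an `m`-multigraph on `n` vertices whose edge multiset is `E`:
the entry at `(i_1,…,i_m)` is `1/(m-1)!` if the multiset `{i_1,…,i_m}` is an edge, else `0`. -/
def adjT (n m : ℕ) (E : Multiset (Multiset (Fin n))) : (Fin m → Fin n) → ℝ :=
  fun j => if (↑(List.ofFn j) : Multiset (Fin n)) ∈ E then
    1 / (Nat.factorial (m - 1) : ℝ) else 0

/-- The adjacency tensor of an `m`-graph on `n` vertices whose edge set is `E`:
the entry at `(i_1,…,i_m)` is `1/(m-1)!` if `i_1,…,i_m` are pairwise distinct and the set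
`{i_1,…,i_m}` is an edge, else `0`. -/
def adjTG (n m : ℕ) (E : Finset (Finset (Fin n))) : (Fin m → Fin n) → ℝ :=
  fun j => if (List.ofFn j).Nodup ∧ (List.ofFn j).toFinset ∈ E then
    1 / (Nat.factorial (m - 1) : ℝ) else 0

/-- Degree of a vertex in a multi-hypergraph: the number of edges containing it
(counted with multiplicity). -/
def degM {n : ℕ} (E : Multiset (Multiset (Fin n))) (v : Fin n) : ℕ :=
  Multiset.card (E.filter (fun e => v ∈ e))

/-- Degree of a vertex in a hypergraph: the number of edges containing it. -/
def degG {n : ℕ} (E : Finset (Finset (Fin n))) (v : Fin n) : ℕ :=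
  (E.filter (fun e => v ∈ e)).card

/-- A multi-hypergraph is connected iff every pair of vertices is joined by a chain
`(x_1, E_1, x_2, E_2, …, E_q, x_{q+1})` with `x_1,…,x_q` distinct vertices,
`E_1,…,E_q` distinct edges, and `x_k, x_{k+1} ∈ E_k` for all `k`. -/
def IsConnectedM {n : ℕ} (E : Multiset (Multiset (Fin n))) : Prop :=
  ∀ u v : Fin n, ∃ (q : ℕ) (x : Fin (q + 1) → Fin n) (ed : Fin q → Multiset (Fin n)),
    x 0 = u ∧ x (Fin.last q) = v ∧
    (∀ k1 k2 : Fin q, k1 ≠ k2 → x k1.castSucc ≠ x k2.castSucc) ∧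
    (∀ k1 k2 : Fin q, k1 ≠ k2 → ed k1 ≠ ed k2) ∧
    (∀ k : Fin q, ed k ∈ E) ∧
    (∀ k : Fin q, x k.castSucc ∈ ed k ∧ x k.succ ∈ ed k)

/-- A nonnegative tensor is weakly irreducible iff its associated directed graph
(with an arc `i → j` whenever `a_{i i_2 … i_m} > 0` for some `i_2,…,i_m` with
`j ∈ {i_2,…,i_m}`) is strongly connected. -/
def WeaklyIrreducible {n m : ℕ} (A : (Fin m → Fin n) → ℝ) : Prop :=
  ∀ i j : Fin n, Relation.ReflTransGen
    (fun a b => ∃ v : Fin (m - 1) → Fin n, (∃ t, v t = b) ∧ 0 < A (consVec a v)) i j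

/-- An `m`-multigraph is nicely-connected iff there is no nonempty proper vertex subset `V₀`
such that no edge has the form `{i, i_2, …, i_m}` with `i ∈ V₀` and `i_2, …, i_m ∉ V₀`. -/
def NicelyConnectedM (n m : ℕ) (E : Multiset (Multiset (Fin n))) : Prop :=
  ¬ ∃ V0 : Finset (Fin n), V0.Nonempty ∧ V0 ≠ Finset.univ ∧
      ∀ (i : Fin n) (j : Fin (m - 1) → Fin n), i ∈ V0 → (∀ t, j t ∉ V0) →
        (i ::ₘ (↑(List.ofFn j) : Multiset (Fin n))) ∉ E

/-- An `m`-graph is nicely-connected iff there is no nonempty vertex subset `V₀` with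
`|V₀| ≤ n - m + 1` such that no edge has the form `{i, i_2, …, i_m}` with `i ∈ V₀` and
`i_2, …, i_m ∉ V₀`. -/
def NicelyConnectedG (n m : ℕ) (E : Finset (Finset (Fin n))) : Prop :=
  ¬ ∃ V0 : Finset (Fin n), V0.Nonempty ∧ V0.card ≤ n - m + 1 ∧
      ∀ (i : Fin n) (j : Fin (m - 1) → Fin n), i ∈ V0 → (∀ t, j t ∉ V0) →
        insert i (List.ofFn j).toFinset ∉ E

/-- A tensor is irreducible iff there is no nonempty proper index subset `I` with
`a_{i_1 i_2 … i_m} = 0` for all `i_1 ∈ I` and `i_2, …, i_m ∉ I`. -/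
def TIrreducible {n m : ℕ} (A : (Fin m → Fin n) → ℝ) : Prop :=
  ¬ ∃ I : Finset (Fin n), I.Nonempty ∧ I ≠ Finset.univ ∧
      ∀ (i : Fin n) (j : Fin (m - 1) → Fin n), i ∈ I → (∀ t, j t ∉ I) →
        A (consVec i j) = 0

theorem consVec_eq_cons {n k : ℕ} (i : Fin n) (j : Fin (k + 1 - 1) → Fin n) :
    consVec (m := k + 1) i j = Fin.cons (α := fun _ => Fin n) i (j : Fin k → Fin n) := by
  funext t
  refine Fin.cases ?_ (fun t => ?_) t <;> simp [consVec]

theorem coe_ofFn_insertNth {α : Type*} {k : ℕ} (p : Fin (k + 1)) (a : α) (j : Fin k → α) :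
    (↑(List.ofFn (Fin.insertNth (α := fun _ => α) p a j)) : Multiset α) =
      a ::ₘ ↑(List.ofFn j) := by
  rw [← Fin.univ_val_map, Fin.univ_succAbove k p, ← Fin.univ_val_map]
  simp [Function.comp_def]

theorem adjT_insertNth {n k : ℕ} (E : Multiset (Multiset (Fin n))) (p : Fin (k + 1))
    (i : Fin n) (j : Fin k → Fin n) :
    adjT n (k + 1) E (Fin.insertNth (α := fun _ => Fin n) p i j) =
      adjT n (k + 1) E (consVec i j) := by
  rw [consVec_eq_cons, ← Fin.insertNth_zero']
  simp only [adjT, coe_ofFn_insertNth]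

theorem adjT_nonneg {n m : ℕ} (E : Multiset (Multiset (Fin n))) (j : Fin m → Fin n) :
    0 ≤ adjT n m E j := by
  unfold adjT
  split_ifs <;> positivity

theorem tForm_smul {n m : ℕ} (A : (Fin m → Fin n) → ℝ) (c : ℝ) (x : Fin n → ℝ) :
    tForm A (c • x) = c ^ m * tForm A x := by
  simp only [tForm, Finset.mul_sum, Pi.smul_apply, smul_eq_mul, Finset.prod_mul_distrib,
    Finset.prod_const, Finset.card_univ, Fintype.card_fin]
  exact Finset.sum_congr rfl fun j _ => by ring

theorem abs_tForm_le {n m : ℕ} {A : (Fin m → Fin n) → ℝ} (hA : ∀ j, 0 ≤ A j)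
    (x : Fin n → ℝ) : |tForm A x| ≤ tForm A (fun i => |x i|) := by
  refine (Finset.abs_sum_le_sum_abs _ _).trans_eq (Finset.sum_congr rfl fun j _ => ?_)
  rw [abs_mul, abs_of_nonneg (hA j), Finset.abs_prod]

theorem continuous_tForm {n m : ℕ} (A : (Fin m → Fin n) → ℝ) : Continuous (tForm A) := by
  unfold tForm
  fun_prop

/-- The partial derivatives of `A x^m` for a symmetric tensor `A`. -/
theorem hasDerivAt_tForm {n k : ℕ} {A : (Fin (k + 1) → Fin n) → ℝ}
    (hA : ∀ (p : Fin (k + 1)) (i : Fin n) (j : Fin k → Fin n),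
      A (Fin.insertNth (α := fun _ => Fin n) p i j) = A (consVec i j))
    (x : Fin n → ℝ) (i : Fin n) :
    HasDerivAt (fun s : ℝ => tForm A (x + s • Pi.single i 1))
      ((k + 1) * tContract A x i) 0 := by
  have hcoord : ∀ a : Fin n, HasDerivAt (fun s : ℝ => (x + s • Pi.single i 1 : Fin n → ℝ) a)
      (Pi.single (M := fun _ => ℝ) i 1 a) 0 := fun a => by
    simpa using ((hasDerivAt_id (0 : ℝ)).mul_const
      (Pi.single (M := fun _ => ℝ) i 1 a)).const_add (x a)
  have hterm : ∀ j : Fin (k + 1) → Fin n, HasDerivAt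
      (fun s : ℝ => A j * ∏ t, (x + s • Pi.single i 1 : Fin n → ℝ) (j t))
      (A j * ∑ t, (∏ u ∈ univ.erase t, x (j u)) * Pi.single (M := fun _ => ℝ) i 1 (j t)) 0 :=
    fun j => by
      have h := (HasDerivAt.fun_finsetProd (u := (univ : Finset (Fin (k + 1))))
        (fun t _ => hcoord (j t))).const_mul (A j)
      simpa using h
  have hsum := HasDerivAt.fun_sum (u := (univ : Finset (Fin (k + 1) → Fin n)))
    (fun j _ => hterm j)
  refine hsum.congr_deriv ?_
  have hpos : ∀ t : Fin (k + 1), ∑ j : Fin (k + 1) → Fin n,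
      A j * ((∏ u ∈ univ.erase t, x (j u)) * Pi.single (M := fun _ => ℝ) i 1 (j t)) =
        tContract A x i := fun t => by
    rw [← (Fin.insertNthEquiv (fun _ => Fin n) t).sum_comp, Fintype.sum_prod_type,
      Finset.sum_eq_single i]
    · refine Finset.sum_congr rfl fun j _ => ?_
      have hprod : ∏ u ∈ univ.erase t,
          x (Fin.insertNth (α := fun _ => Fin n) t i j u) = ∏ u, x (j u) := by
        rw [Fin.univ_succAbove k t, Finset.erase_cons, Finset.prod_map]
        simp
      simp only [Fin.insertNthEquiv_apply, Fin.insertNth_apply_same, Pi.single_eq_same, mul_one]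
      rw [hprod, ← hA t]
      rfl
    · intro b _ hb
      simp [hb]
    · simp
  simp only [Finset.mul_sum]
  rw [Finset.sum_comm, Finset.sum_congr rfl fun t _ => hpos t]
  simp

/-- If `|A y^m| ≤ lam ‖y‖^m` on the line through `x` in direction `i`, with equality at the unit
vector `x`, then `x` satisfies the `i`-th Z-eigenvalue equation. -/
theorem tContract_eq_of_sq_tForm_le {n k : ℕ} {A : (Fin (k + 1) → Fin n) → ℝ}
    (hA : ∀ (p : Fin (k + 1)) (i : Fin n) (j : Fin k → Fin n),
      A (Fin.insertNth (α := fun _ => Fin n) p i j) = A (consVec i j))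
    {x : Fin n → ℝ} (hx : ∑ a, x a ^ 2 = 1) (hpos : tForm A x ≠ 0) (i : Fin n)
    (hle : ∀ s : ℝ, tForm A (x + s • Pi.single i 1) ^ 2 ≤
      tForm A x ^ 2 * (∑ a, (x + s • Pi.single i 1 : Fin n → ℝ) a ^ 2) ^ (k + 1)) :
    tContract A x i = tForm A x * x i := by
  have hnorm : HasDerivAt (fun s : ℝ => ∑ a, (x + s • Pi.single i 1 : Fin n → ℝ) a ^ 2)
      (2 * x i) 0 := by
    have hcoord : ∀ a : Fin n, HasDerivAt (fun s : ℝ => (x + s • Pi.single i 1 : Fin n → ℝ) a ^ 2)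
        (2 * x a * Pi.single (M := fun _ => ℝ) i 1 a) 0 := fun a => by
      simpa using (((hasDerivAt_id (0 : ℝ)).mul_const
        (Pi.single (M := fun _ => ℝ) i 1 a)).const_add (x a)).fun_pow 2
    refine (HasDerivAt.fun_sum (u := univ) fun a _ => hcoord a).congr_deriv ?_
    simp [Pi.single_apply]
  have hd := ((hnorm.fun_pow (k + 1)).const_mul (tForm A x ^ 2)).fun_sub
    ((hasDerivAt_tForm hA x i).fun_pow 2)
  have hmin : IsLocalMin (fun s : ℝ =>
      tForm A x ^ 2 * (∑ a, (x + s • Pi.single i 1 : Fin n → ℝ) a ^ 2) ^ (k + 1) -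
        tForm A (x + s • Pi.single i 1) ^ 2) 0 :=
    Filter.Eventually.of_forall fun s => by
      simpa [hx] using hle s
  have h := hmin.hasDerivAt_eq_zero hd
  simp only [zero_smul, add_zero, hx, one_pow, Nat.cast_add, Nat.cast_one] at h
  have hk : (0 : ℝ) < k + 1 := by positivity
  have h' : (2 * tForm A x * (k + 1)) * (tForm A x * x i - tContract A x i) = 0 := by
    simp only [Nat.cast_ofNat, pow_one, Nat.reduceSub] at h
    linear_combination h
  have := (mul_eq_zero.mp h').resolve_left
    (mul_ne_zero (mul_ne_zero two_ne_zero hpos) hk.ne')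
  linarith

/-- `A x^m` attains its maximum over the nonnegative unit vectors vanishing on `V0`, and the
maximum bounds it on the whole coordinate subspace. -/
theorem exists_sq_tForm_le {n k : ℕ} {A : (Fin (k + 1) → Fin n) → ℝ} (hA : ∀ j, 0 ≤ A j)
    {V0 : Finset (Fin n)} (hV0 : V0 ≠ univ) :
    ∃ x : Fin n → ℝ, (∀ i, 0 ≤ x i) ∧ ∑ i, x i ^ 2 = 1 ∧ (∀ i ∈ V0, x i = 0) ∧
      ∀ y : Fin n → ℝ, (∀ i ∈ V0, y i = 0) →
        tForm A y ^ 2 ≤ tForm A x ^ 2 * (∑ i, y i ^ 2) ^ (k + 1) := by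
  let K : Set (Fin n → ℝ) :=
    {x | (∀ i, 0 ≤ x i) ∧ ∑ i, x i ^ 2 = 1 ∧ ∀ i ∈ V0, x i = 0}
  have hclosed : IsClosed K := by
    have h₁ : IsClosed {x : Fin n → ℝ | ∀ i, 0 ≤ x i} := by
      simp only [Set.ofPred_forall]
      exact isClosed_iInter fun i => isClosed_le continuous_const (continuous_apply i)
    have h₂ : IsClosed {x : Fin n → ℝ | ∑ i, x i ^ 2 = 1} :=
      isClosed_eq (by fun_prop) continuous_const
    have h₃ : IsClosed {x : Fin n → ℝ | ∀ i ∈ V0, x i = 0} := by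
      simp only [Set.ofPred_forall]
      exact isClosed_iInter fun i => isClosed_iInter fun _ =>
        isClosed_eq (continuous_apply i) continuous_const
    exact h₁.inter (h₂.inter h₃)
  have hsub : K ⊆ Set.Icc 0 1 := fun x hx => ⟨hx.1, fun i => by
    have h := Finset.single_le_sum (f := fun i => x i ^ 2) (fun i _ => sq_nonneg (x i))
      (Finset.mem_univ i)
    rw [hx.2.1] at h
    exact (sq_le_one_iff₀ (hx.1 i)).mp h⟩
  have hcompact : IsCompact K := isCompact_Icc.of_isClosed_subset hclosed hsub
  obtain ⟨v, hv⟩ : ∃ v, v ∉ V0 := by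
    by_contra! h
    exact hV0 (Finset.eq_univ_iff_forall.mpr h)
  have hne : K.Nonempty := by
    refine ⟨Pi.single v 1, fun i => ?_, ?_, fun i hi => ?_⟩
    · simp only [Pi.single_apply]
      split_ifs <;> norm_num
    · simp [Pi.single_apply]
    · exact Pi.single_eq_of_ne (fun h : i = v => hv (h ▸ hi)) _
  obtain ⟨x, hx, hmax⟩ := hcompact.exists_isMaxOn hne (continuous_tForm A).continuousOn
  refine ⟨x, hx.1, hx.2.1, hx.2.2, fun y hy => ?_⟩
  have hN : 0 ≤ ∑ i, y i ^ 2 := Finset.sum_nonneg fun i _ => sq_nonneg _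
  rcases hN.eq_or_lt with hN0 | hNpos
  · have hy0 : y = 0 := funext fun i => by
      simpa using (Finset.sum_eq_zero_iff_of_nonneg fun i _ => sq_nonneg (y i)).mp hN0.symm i
        (Finset.mem_univ i)
    subst hy0
    simp [tForm]
  · set r := √(∑ i, y i ^ 2)
    have hrpos : 0 < r := Real.sqrt_pos.mpr hNpos
    have hrsq : r ^ 2 = ∑ i, y i ^ 2 := Real.sq_sqrt hN
    have hyr : y = r • (r⁻¹ • y) := by rw [smul_inv_smul₀ hrpos.ne']
    have hmem : (fun i => |(r⁻¹ • y) i|) ∈ K := by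
      refine ⟨fun i => abs_nonneg _, ?_, fun i hi => by simp [hy i hi]⟩
      simp only [sq_abs, Pi.smul_apply, smul_eq_mul, mul_pow, ← Finset.mul_sum, ← hrsq]
      field_simp
    have hle : |tForm A (r⁻¹ • y)| ≤ tForm A x := (abs_tForm_le hA _).trans (hmax hmem)
    have hsq : tForm A (r⁻¹ • y) ^ 2 ≤ tForm A x ^ 2 := sq_le_sq.mpr (hle.trans (le_abs_self _))
    rw [← hrsq, hyr, tForm_smul, mul_pow, ← pow_mul, ← pow_mul, mul_comm (k + 1) 2, mul_comm]
    exact mul_le_mul_of_nonneg_right hsq (by positivity)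

/-- If an m-multigraph is not nicely-connected, witnessed by a nonempty proper
V₀ blocking all edges {i, i_2, …, i_m} with i ∈ V₀, i_2,…,i_m ∉ V₀, and some edge lies
entirely outside V₀, then A_H has a Z-eigenpair (λ, x) with λ > 0, x ≥ 0, and x vanishing
on V₀ (in particular x has a zero coordinate). -/
theorem stmt6 (n m : ℕ) (hm : 2 ≤ m) (E : Multiset (Multiset (Fin n)))
    (hE : ∀ e ∈ E, Multiset.card e = m)
    (V0 : Finset (Fin n)) (h0 : V0.Nonempty) (h1 : V0 ≠ Finset.univ)
    (hblock : ∀ (i : Fin n) (j : Fin (m - 1) → Fin n), i ∈ V0 → (∀ t, j t ∉ V0) →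
      (i ::ₘ (↑(List.ofFn j) : Multiset (Fin n))) ∉ E)
    (hedge : ∃ e ∈ E, ∀ v ∈ e, v ∉ V0) :
    ∃ (lam : ℝ) (x : Fin n → ℝ), 0 < lam ∧ (∀ i, 0 ≤ x i) ∧
      (∀ i, tContract (adjT n m E) x i = lam * x i) ∧ (∑ i, (x i) ^ 2 = 1) ∧
      (∀ i ∈ V0, x i = 0) ∧ (∃ i, x i = 0) := by
  obtain ⟨k, rfl⟩ : ∃ k, m = k + 1 := ⟨m - 1, by omega⟩
  have hA := adjT_nonneg (m := k + 1) E
  obtain ⟨x, hx0, hx1, hxV, hmax⟩ := exists_sq_tForm_le hA h1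
  have hne : tForm (adjT n (k + 1) E) x ≠ 0 := by
    obtain ⟨e, he, heV⟩ := hedge
    obtain ⟨l, rfl⟩ := Quot.exists_rep e
    have hl : l.length = k + 1 := hE _ he
    let j : Fin (k + 1) → Fin n := fun t => l.get (t.cast hl.symm)
    have hj : List.ofFn j = l := List.ext_get (by simp [hl]) fun a _ _ => by
      simp [j, -List.ofFn_succ]
    let y : Fin n → ℝ := fun i => if i ∈ V0 then 0 else 1
    have hy0 : ∀ i, 0 ≤ y i := fun i => by dsimp only [y]; split_ifs <;> norm_num
    have hyj : ∀ t, y (j t) = 1 := fun t => if_neg (heV _ (List.get_mem _ _))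
    have hAj : 0 < adjT n (k + 1) E j := by
      rw [adjT, if_pos (by rw [hj]; exact he)]
      positivity
    have hypos : 0 < tForm (adjT n (k + 1) E) y :=
      Finset.sum_pos' (fun j _ => mul_nonneg (hA j) (Finset.prod_nonneg fun t _ => hy0 _))
        ⟨j, Finset.mem_univ j, by simpa [hyj] using hAj⟩
    intro h
    have hle := hmax y fun i hi => if_pos hi
    rw [h] at hle
    have hsq := pow_pos hypos 2
    simp only [ne_eq, OfNat.ofNat_ne_zero, not_false_eq_true, zero_pow, zero_mul] at hle
    linarith
  have hnonneg : 0 ≤ tForm (adjT n (k + 1) E) x :=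
    Finset.sum_nonneg fun j _ => mul_nonneg (hA j) (Finset.prod_nonneg fun t _ => hx0 _)
  refine ⟨tForm (adjT n (k + 1) E) x, x, hnonneg.lt_of_ne' hne, hx0, fun i => ?_, hx1, hxV,
    h0.imp fun i hi => hxV i hi⟩
  by_cases hi : i ∈ V0
  · rw [hxV i hi, mul_zero]
    refine Finset.sum_eq_zero fun j _ => ?_
    by_cases hj : ∀ t, j t ∉ V0
    · have hnot := hblock i j hi hj
      have hcons : (↑(List.ofFn (consVec (m := k + 1) i j)) : Multiset (Fin n)) =
          i ::ₘ ↑(List.ofFn j) := by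
        rw [consVec_eq_cons, ← Fin.insertNth_zero', coe_ofFn_insertNth]
      rw [adjT, hcons, if_neg hnot, zero_mul]
    · push Not at hj
      obtain ⟨t, ht⟩ := hj
      rw [Finset.prod_eq_zero (Finset.mem_univ t) (hxV _ ht), mul_zero]
  · refine tContract_eq_of_sq_tForm_le (adjT_insertNth E) hx1 hne i fun s => hmax _ fun a ha => ?_
    simp [hxV a ha, Pi.single_eq_of_ne (fun h : a = i => hi (h ▸ ha))]
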